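/- Let a be a C^∞-smooth boundary point of a ℂ-convex domain D ⊆ ℂ^n, let X ∈ ℂ^n be a nonzero vector with finite line type l_{a,X} < ∞, and let n_a denote the inner normal line to ∂D at a. Then there exist a neighborhood U of a and a constant c > 0 such that c^{-1}·d_D(z)^{-1/l_{a,X}} ≤ γ_D(z;X) ≤ κ_D(z;X) ≤ c·d_D(z)^{-1/l_{a,X}} for all z ∈ D ∩ U ∩ n_a, where d_D(z) is the Euclidean distance from z to ∂D. -/

import Mathlib

open Complex Metric Set MeasureTheory

noncomputable section

/-- `ℂ^n` with the Euclidean (Hermitian) structure. -/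
abbrev Cn (n : ℕ) := EuclideanSpace ℂ (Fin n)

instance (n : ℕ) : MeasurableSpace (Cn n) := borel _
instance (n : ℕ) : BorelSpace (Cn n) := ⟨rfl⟩

/-- The complex affine line through `z` in direction `X`. -/
def cline {n : ℕ} (z X : Cn n) : Set (Cn n) := {w | ∃ l : ℂ, w = z + l • X}

/-- A domain: a nonempty connected open set. -/
def IsDomain' {n : ℕ} (D : Set (Cn n)) : Prop := IsOpen D ∧ IsConnected D

/-- `D` is ℂ-convex: its intersection with every complex affine line is, when
nonempty, connected and simply connected. -/
def IsCConvex {n : ℕ} (D : Set (Cn n)) : Prop :=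
  ∀ z X : Cn n, X ≠ 0 → (D ∩ cline z X).Nonempty →
    IsConnected (D ∩ cline z X) ∧ SimplyConnectedSpace ↥(D ∩ cline z X)

/-- The Carathéodory metric `γ_D(z;X)`. -/
def caraMetric {n : ℕ} (D : Set (Cn n)) (z X : Cn n) : ℝ :=
  sSup {r : ℝ | ∃ f : Cn n → ℂ, DifferentiableOn ℂ f D ∧ MapsTo f D (ball (0:ℂ) 1) ∧
    f z = 0 ∧ r = ‖fderiv ℂ f z X‖}

/-- The Kobayashi metric `κ_D(z;X)`. -/
def kobMetric {n : ℕ} (D : Set (Cn n)) (z X : Cn n) : ℝ :=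
  sInf {a : ℝ | 0 ≤ a ∧ ∃ φ : ℂ → Cn n, DifferentiableOn ℂ φ (ball (0:ℂ) 1) ∧
    MapsTo φ (ball (0:ℂ) 1) D ∧ φ 0 = z ∧ a • (fderiv ℂ φ 0 1) = X}

/-- The distance `d_D(z,X)` from `z` to `∂D` in direction `X`. -/
def dirDist {n : ℕ} (D : Set (Cn n)) (z X : Cn n) : ℝ :=
  sSup {r : ℝ | 0 < r ∧ ∀ l : ℂ, ‖l‖ < r → z + l • X ∈ D}

/-- The Euclidean distance `d_D(z)` from `z` to `∂D`. -/
def bdist {n : ℕ} (D : Set (Cn n)) (z : Cn n) : ℝ := Metric.infDist z (frontier D)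

/-- `L_a`: the set of vectors `X` such that a disc `{a + λX : |λ| < ε}` lies in `∂D`. -/
def La {n : ℕ} (D : Set (Cn n)) (a : Cn n) : Set (Cn n) :=
  {X | ∃ ε > (0:ℝ), ∀ l : ℂ, ‖l‖ < ε → a + l • X ∈ frontier D}

/-- `D` contains no complex affine line. -/
def NoComplexLine {n : ℕ} (D : Set (Cn n)) : Prop :=
  ¬ ∃ z X : Cn n, X ≠ 0 ∧ cline z X ⊆ D

/-- The Bergman kernel `K_D(z)` (restricted to the diagonal). -/
def bergmanKernel {n : ℕ} (D : Set (Cn n)) (z : Cn n) : ℝ :=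
  sSup {r : ℝ | ∃ f : Cn n → ℂ, DifferentiableOn ℂ f D ∧
    IntegrableOn (fun w => ‖f w‖ ^ 2) D ∧ (∫ w in D, ‖f w‖ ^ 2) ≤ 1 ∧ r = ‖f z‖ ^ 2}

/-- `M_D(z;X)`. -/
def bergmanM {n : ℕ} (D : Set (Cn n)) (z X : Cn n) : ℝ :=
  sSup {r : ℝ | ∃ f : Cn n → ℂ, DifferentiableOn ℂ f D ∧
    IntegrableOn (fun w => ‖f w‖ ^ 2) D ∧ (∫ w in D, ‖f w‖ ^ 2) = 1 ∧
    f z = 0 ∧ r = ‖fderiv ℂ f z X‖}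

/-- The Bergman metric `B_D(z;X) = M_D(z;X)/√K_D(z)`. -/
def bergmanMetric {n : ℕ} (D : Set (Cn n)) (z X : Cn n) : ℝ :=
  bergmanM D z X / Real.sqrt (bergmanKernel D z)

/-- `G` is weakly linearly convex: through every boundary point there is a complex
affine hyperplane missing `G`. -/
def WeaklyLinConvex {n : ℕ} (G : Set (Cn n)) : Prop :=
  ∀ a ∈ frontier G, ∃ ℓ : Cn n →L[ℂ] ℂ, ℓ ≠ 0 ∧ ∀ z ∈ G, ℓ z ≠ ℓ a

/-- `d_{j,D}(z)` from the minimal-distance construction: the distance from `z` to the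
boundary of the slice of `D` by the affine subspace `z + span{v_i : i ≥ j}`. -/
def sliceDist {n : ℕ} (D : Set (Cn n)) (z : Cn n) (v : Fin n → Cn n) (j : Fin n) : ℝ :=
  sSup {r : ℝ | 0 < r ∧
    ∀ w ∈ Submodule.span ℂ (v '' {i | j ≤ i}), ‖w‖ < r → z + w ∈ D}

/-- The data `(v j)` is an admissible output of the minimal-distance construction at `z`:
the directions are orthonormal and each `v j` realizes the distance `d_{j,D}(z)` to the
boundary of the corresponding slice. -/
def MinimalBasis {n : ℕ} (D : Set (Cn n)) (z : Cn n) (v : Fin n → Cn n) : Prop :=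
  Orthonormal ℂ v ∧ ∀ j : Fin n, z + (sliceDist D z v j) • v j ∉ D

/-- A continuous function on a preconnected space with constant exponential is constant. -/
lemma eq_of_exp_eq_const {A : Type*} [TopologicalSpace A] [PreconnectedSpace A] {f : A → ℂ}
    (hf : Continuous f) {c : ℂ} (h : ∀ a, exp (f a) = c) (a b : A) : f a = f b := by
  have := isCoveringMap_exp.eq_of_comp_eq hf (continuous_const (y := f b))
    (funext fun x => Subtype.ext ((h x).trans (h b).symm)) b rfl
  exact congrFun this a

/-- Continuous logarithms along a family of simply connected plane domains: the increment from
`0` to `1` of a branch of `log g(p, ·)` depends continuously on `p`. -/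
lemma exists_continuous_log_increment {P : Type*} [TopologicalSpace P] {W : Set (P × ℂ)}
    (hW : IsOpen W) (hsc : ∀ p, IsSimplyConnected {x : ℂ | (p, x) ∈ W})
    (h0 : ∀ p, (p, (0 : ℂ)) ∈ W) (h1 : ∀ p, (p, (1 : ℂ)) ∈ W)
    {g : P × ℂ → ℂ} (hg : ContinuousOn g W) (hg0 : ∀ x ∈ W, g x ≠ 0) :
    ∃ k : P → ℂ, Continuous k ∧ ∀ p, exp (k p) * g (p, 0) = g (p, 1) := by
  have hF : ∀ p, ∃ F : ℂ → ℂ, ContinuousOn F {x : ℂ | (p, x) ∈ W} ∧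
      EqOn (exp ∘ F) (fun x => g (p, x)) {x : ℂ | (p, x) ∈ W} := fun p =>
    exists_continuousOn_eqOn_exp_comp (hsc p) (hW.preimage (by fun_prop))
      (hg.comp (f := fun x : ℂ => (p, x)) (by fun_prop) fun x hx => hx) (by
        rintro ⟨x, hx, h⟩
        exact hg0 _ hx h)
  choose F hFc hFe using hF
  refine ⟨fun p => F p 1 - F p 0, continuous_iff_continuousAt.2 fun p₀ => ?_, fun p => ?_⟩
  swap
  · have e0 := hFe p (h0 p)
    have e1 := hFe p (h1 p)
    simp only [Function.comp] at e0 e1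
    rw [exp_sub, e0, e1, div_mul_cancel₀ _ (hg0 _ (h0 p))]
  obtain ⟨c, hc⟩ := (hsc p₀).isPathConnected.joinedIn 0 (h0 p₀) 1 (h1 p₀)
  have hratio : ∀ x : ℂ, (p₀, x) ∈ W →
      ContinuousAt (fun y : P × ℂ => g y / g (p₀, y.2)) (p₀, x) := by
    intro x hx
    have hgx : ContinuousAt g (p₀, x) := hg.continuousAt (hW.mem_nhds hx)
    refine hgx.div ?_ (hg0 _ hx)
    exact ContinuousAt.comp (f := fun y : P × ℂ => (p₀, y.2)) (g := g) (x := (p₀, x)) hgx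
      (by fun_prop)
  have hev : ∀ᶠ p in nhds p₀, ∀ t ∈ (univ : Set unitInterval), (p, c t) ∈ W ∧
      g (p, c t) / g (p₀, c t) ∈ ball (1 : ℂ) 1 := by
    refine isCompact_univ.eventually_forall_of_forall_eventually fun t _ => ?_
    have hcont : ContinuousAt (fun q : P × unitInterval => (q.1, c q.2)) (p₀, t) := by fun_prop
    refine (hcont.eventually (hW.mem_nhds (hc t))).and ?_
    refine (ContinuousAt.comp (f := fun q : P × unitInterval => (q.1, c q.2)) (hratio _ (hc t))
      hcont).eventually (isOpen_ball.mem_nhds ?_)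
    simp [div_self (hg0 _ (hc t))]
  have hslit : ∀ z ∈ ball (1 : ℂ) 1, z ∈ slitPlane := fun z hz => by
    have := mem_slitPlane_of_norm_lt_one (z := z - 1) (by simpa [dist_eq_norm] using hz)
    simpa using this
  have key : ∀ᶠ p in nhds p₀, F p₀ 1 - F p₀ 0 +
      (log (g (p, 1) / g (p₀, 1)) - log (g (p, 0) / g (p₀, 0))) = F p 1 - F p 0 := by
    filter_upwards [hev] with p hp
    have hcont : Continuous fun t : unitInterval =>
        F p (c t) - F p₀ (c t) - log (g (p, c t) / g (p₀, c t)) := by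
      refine ((hFc p).comp_continuous c.continuous fun t => (hp t trivial).1).sub
        ((hFc p₀).comp_continuous c.continuous hc) |>.sub ?_
      refine Continuous.clog ?_ fun t => hslit _ (hp t trivial).2
      refine (hg.comp_continuous (by fun_prop) fun t => (hp t trivial).1).div
        (hg.comp_continuous (by fun_prop) hc) fun t => hg0 _ (hc t)
    have hconst := eq_of_exp_eq_const hcont (c := 1) (fun t => by
      have e0 := hFe p (hp t trivial).1
      have e1 := hFe p₀ (hc t)
      have n0 := hg0 _ (hp t trivial).1
      have n1 := hg0 _ (hc t)
      simp only [Function.comp] at e0 e1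
      rw [exp_sub, exp_sub, e0, e1, exp_log (div_ne_zero n0 n1), div_self (div_ne_zero n0 n1)]) 0 1
    simp only [Path.source, Path.target] at hconst
    linear_combination hconst
  refine ContinuousAt.congr ?_ key
  have hl : ∀ x : ℂ, (p₀, x) ∈ W → ContinuousAt (fun p => log (g (p, x) / g (p₀, x))) p₀ := by
    intro x hx
    refine ContinuousAt.clog ?_ ?_
    · exact ContinuousAt.comp (f := fun p => (p, x)) (hratio x hx) (by fun_prop)
    · simp [div_self (hg0 _ hx)]
  exact continuousAt_const.add ((hl 1 (h1 p₀)).sub (hl 0 (h0 p₀)))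

/-- The complex line slices of a ℂ-convex set are simply connected in the affine parameter. -/
lemma IsCConvex.isSimplyConnected_slice {n : ℕ} {D : Set (Cn n)} (hD : IsCConvex D)
    (z X : Cn n) (h : ∃ x : ℂ, z + x • X ∈ D) : IsSimplyConnected {x : ℂ | z + x • X ∈ D} := by
  rcases eq_or_ne X 0 with rfl | hX
  · have : {x : ℂ | z + x • (0 : Cn n) ∈ D} = univ := by
      obtain ⟨x, hx⟩ := h
      ext y
      simpa using hx
    rw [this]
    exact (Homeomorph.Set.univ ℂ).toHomotopyEquiv.simplyConnectedSpace_iff.2 inferInstance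
  have hemb : Topology.IsEmbedding fun x : ℂ => z + x • X :=
    (Homeomorph.addLeft z).isEmbedding.comp (isClosedEmbedding_smul_left hX).isEmbedding
  rw [← hemb.isSimplyConnected_image]
  have himg : (fun x : ℂ => z + x • X) '' {x : ℂ | z + x • X ∈ D} = D ∩ cline z X := by
    ext w
    constructor
    · rintro ⟨x, hx, rfl⟩
      exact ⟨hx, x, rfl⟩
    · rintro ⟨hw, x, rfl⟩
      exact ⟨x, hw, rfl⟩
  rw [himg]
  obtain ⟨x, hx⟩ := h
  exact (hD z X hX ⟨_, hx, x, rfl⟩).2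

/-- On a ℂ-convex domain every zero-free holomorphic function has a holomorphic logarithm. -/
lemma IsCConvex.exists_holomorphic_log {n : ℕ} {D : Set (Cn n)} (hD : IsCConvex D)
    (hDo : IsOpen D) {z : Cn n} (hz : z ∈ D) {q : Cn n → ℂ} (hq : DifferentiableOn ℂ q D)
    (hq0 : ∀ w ∈ D, q w ≠ 0) :
    ∃ k : Cn n → ℂ, DifferentiableOn ℂ k D ∧ ∀ w ∈ D, exp (k w) * q z = q w := by
  classical
  have hmap : Continuous fun x : D × ℂ => z + x.2 • ((x.1 : Cn n) - z) := by fun_prop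
  obtain ⟨W, hW⟩ : ∃ W : Set (D × ℂ), ∀ p y, (p, y) ∈ W ↔ z + y • ((p : Cn n) - z) ∈ D :=
    ⟨{x | z + x.2 • ((x.1 : Cn n) - z) ∈ D}, fun _ _ => Iff.rfl⟩
  have hWo : IsOpen W := by
    convert hDo.preimage hmap
    ext ⟨p, y⟩
    exact hW p y
  obtain ⟨g, hg⟩ : ∃ g : D × ℂ → ℂ, ∀ p y, g (p, y) = q (z + y • ((p : Cn n) - z)) :=
    ⟨fun x => q (z + x.2 • ((x.1 : Cn n) - z)), fun _ _ => rfl⟩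
  have hgc : ContinuousOn g W := by
    refine (hq.continuousOn.comp hmap.continuousOn (s := W) ?_).congr ?_
    · rintro ⟨p, y⟩ h
      exact (hW p y).1 h
    · rintro ⟨p, y⟩ -
      exact hg p y
  obtain ⟨k, hk, hke⟩ := exists_continuous_log_increment hWo
    (fun p => by
      simp only [hW]
      exact hD.isSimplyConnected_slice z _ ⟨0, by simpa using hz⟩)
    (fun p => by simpa [hW] using hz) (fun p => by simp [hW]) hgc
    (fun ⟨p, y⟩ h => by
      rw [hg]
      exact hq0 _ ((hW p y).1 h))
  obtain ⟨K, hK⟩ : ∃ K : Cn n → ℂ, ∀ w : D, K w = k w :=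
    ⟨fun w => if hw : w ∈ D then k ⟨w, hw⟩ else 0, by simp⟩
  have hKe : ∀ w ∈ D, exp (K w) * q z = q w := fun w hw => by
    simpa [hK ⟨w, hw⟩, hg] using hke ⟨w, hw⟩
  have hKc : ContinuousOn K D := by
    rw [continuousOn_iff_continuous_domRestrict]
    exact hk.congr fun w => (hK w).symm
  refine ⟨K, fun w hw => DifferentiableAt.differentiableWithinAt ?_, hKe⟩
  have hwD := hDo.mem_nhds hw
  have hev : (fun y => K w + log (q y / q w)) =ᶠ[nhds w] K := by
    have hc : ContinuousAt (fun y => K y - K w) w := (hKc.continuousAt hwD).sub continuousAt_const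
    have hball : ball (0 : ℂ) 1 ∈ nhds (K w - K w) := by
      rw [sub_self]
      exact ball_mem_nhds _ one_pos
    filter_upwards [hwD, hc.preimage_mem_nhds hball] with y hy hy'
    have him : |(K y - K w).im| < 1 := by
      refine (abs_im_le_norm _).trans_lt ?_
      simpa using hy'
    have hqz := hq0 _ hz
    have : q y / q w = exp (K y - K w) := by
      rw [← hKe y hy, ← hKe w hw, mul_div_mul_right _ _ hqz, exp_sub]
    rw [this, log_exp]
    · ring
    · linarith [(abs_lt.1 him).1, Real.pi_gt_three]
    · linarith [(abs_lt.1 him).2, Real.pi_gt_three]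
  refine DifferentiableAt.congr_of_eventuallyEq ?_ hev.symm
  have hd : DifferentiableAt ℂ q w := hq.differentiableAt hwD
  refine (differentiableAt_const _).add (DifferentiableAt.clog
    (by simpa only [div_eq_mul_inv] using hd.mul_const (q w)⁻¹) ?_)
  simp [div_self (hq0 w hw)]

/-- If a complex hyperplane through `b = z + x • X` misses a ℂ-convex domain `D` containing the
disc `{z + y • X : ‖y‖ < ‖x‖}`, then `D` carries a holomorphic function into the unit disc
vanishing at `z` whose derivative in direction `X` is comparable to `‖x‖⁻¹`. -/
lemma IsCConvex.exists_caratheodory_candidate {n : ℕ} {D : Set (Cn n)} (hD : IsCConvex D)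
    (hDo : IsOpen D) {z X : Cn n} (hz : z ∈ D) {x : ℂ} (hx : x ≠ 0)
    (hdisc : ∀ y : ℂ, ‖y‖ < ‖x‖ → z + y • X ∈ D) (L : Cn n →L[ℂ] ℂ)
    (hL : ∀ w ∈ D, L w ≠ L (z + x • X)) :
    ∃ f : Cn n → ℂ, DifferentiableOn ℂ f D ∧ MapsTo f D (ball (0 : ℂ) 1) ∧ f z = 0 ∧
      ‖fderiv ℂ f z X‖ = (32 * Real.pi ^ 2 * ‖x‖)⁻¹ := by
  set b := z + x • X with hb
  have hzD := hDo.mem_nhds hz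
  have hq0 : ∀ w ∈ D, L w - L b ≠ 0 := fun w hw => sub_ne_zero.2 (hL w hw)
  have hqz : L z - L b = -x * L X := by simp [hb]
  obtain ⟨k, hk, hke⟩ := hD.exists_holomorphic_log hDo hz (q := fun w => L w - L b)
    (by fun_prop) hq0
  have hkc := hk.continuousOn
  have hkz : exp (k z) = 1 := mul_right_cancel₀ (hq0 z hz) ((hke z hz).trans (one_mul _).symm)
  have hfib : ∀ w ∈ D, ∀ w' ∈ D, L w = L w' → k w = k w' := by
    intro w hw w' hw' h
    have hs := (hD.isSimplyConnected_slice w (w' - w)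
      ⟨0, by simpa using hw⟩).isPathConnected.isConnected.isPreconnected
    have := Subtype.preconnectedSpace hs
    have := eq_of_exp_eq_const
      (f := fun y : {y : ℂ | w + y • (w' - w) ∈ D} => k (w + (y : ℂ) • (w' - w)))
      (c := exp (k w)) (hkc.comp_continuous (by fun_prop) fun y => y.2)
      (fun y => mul_right_cancel₀ (hq0 z hz) (by
        rw [hke _ y.2, hke _ hw]
        simp [h])) ⟨0, by simpa using hw⟩ ⟨1, by simpa using hw'⟩
    simpa using this
  have homit : ∀ w ∈ D, 1 / 2 ≤ ‖k w - k z - 2 * Real.pi * I‖ := by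
    intro w hw
    by_contra! hlt
    set u := k w - k z - 2 * Real.pi * I with hu
    have hexpu : exp u * (L z - L b) = L w - L b := by
      rw [hu, exp_sub, exp_sub, exp_two_pi_mul_I, hkz, div_one, div_one]
      exact hke w hw
    have hmem : ∀ t : unitInterval, z + ((1 - exp ((t : ℝ) * u)) * x) • X ∈ D := by
      intro t
      apply hdisc
      have ht : ‖((t : ℝ) : ℂ) * u‖ < 1 / 2 := by
        rw [norm_mul, norm_real, Real.norm_of_nonneg t.2.1]
        exact (mul_le_of_le_one_left (norm_nonneg _) t.2.2).trans_lt hlt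
      have h1 := norm_exp_sub_one_le (x := ((t : ℝ) : ℂ) * u) (by linarith)
      rw [norm_mul, norm_sub_rev]
      exact mul_lt_of_lt_one_left (norm_pos_iff.2 hx) (by linarith)
    have hval : ∀ t : unitInterval, L (z + ((1 - exp ((t : ℝ) * u)) * x) • X) - L b
        = exp ((t : ℝ) * u) * (L z - L b) := by
      intro t
      rw [hqz]
      simp only [map_add, map_smul, smul_eq_mul, hb]
      ring
    have hconst := eq_of_exp_eq_const
      (f := fun t : unitInterval => k (z + ((1 - exp ((t : ℝ) * u)) * x) • X) - (t : ℝ) * u)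
      (c := 1) ((hkc.comp_continuous (by fun_prop) hmem).sub (by fun_prop)) (fun t => by
        have h := hke _ (hmem t)
        rw [hval t] at h
        rw [exp_sub, mul_right_cancel₀ (hq0 z hz) h, div_self (exp_ne_zero _)]) 1 0
    have h1 := hfib w hw _ (hmem 1) (by
      have h := hval 1
      simp only [Set.Icc.coe_one, ofReal_one, one_mul] at h ⊢
      rw [hexpu] at h
      exact (sub_left_inj.1 h).symm)
    simp only [Set.Icc.coe_one, ofReal_one, one_mul, Set.Icc.coe_zero, ofReal_zero,
      zero_mul, exp_zero, sub_self, zero_smul, add_zero, sub_zero] at hconst h1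
    rw [← h1, hu] at hconst
    have : (2 * Real.pi * I : ℂ) = 0 := by linear_combination hconst
    exact two_pi_I_ne_zero this
  have hpi : ‖(2 * Real.pi * I : ℂ)‖ = 2 * Real.pi := by
    simp [abs_of_pos Real.pi_pos]
  have hne : ∀ w ∈ D, k w - k z - 2 * Real.pi * I ≠ 0 := fun w hw h => by
    have := homit w hw
    rw [h, norm_zero] at this
    norm_num at this
  refine ⟨fun w => 1 / 8 * ((k w - k z - 2 * Real.pi * I)⁻¹ - (-(2 * Real.pi * I))⁻¹),
    ?_, ?_, ?_, ?_⟩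
  · exact (((hk.sub_const _).sub_const _).inv hne |>.sub_const _).const_mul _
  · intro w hw
    have e1 : ‖(k w - k z - 2 * Real.pi * I)⁻¹‖ ≤ 2 := by
      rw [norm_inv]
      exact inv_le_of_inv_le₀ two_pos (by linarith [homit w hw])
    have e2 : ‖(-(2 * Real.pi * I) : ℂ)⁻¹‖ ≤ 2 := by
      rw [norm_inv, norm_neg, hpi]
      exact inv_le_of_inv_le₀ two_pos (by linarith [Real.pi_gt_three])
    rw [mem_ball_zero_iff, norm_mul]
    have := norm_sub_le (k w - k z - 2 * Real.pi * I)⁻¹ (-(2 * Real.pi * I) : ℂ)⁻¹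
    have e8 : ‖(1 / 8 : ℂ)‖ = 1 / 8 := by norm_num
    rw [e8]
    linarith
  · simp
  · have hkd : HasFDerivAt k (fderiv ℂ k z) z := (hk.differentiableAt hzD).hasFDerivAt
    have hder : fderiv ℂ k z X * x = -1 := by
      have h1 := (hkd.cexp.mul_const (L z - L b))
      have h2 : HasFDerivAt (fun w => L w - L b) L z := L.hasFDerivAt.sub_const _
      have h3 := h1.unique (h2.congr_of_eventuallyEq (by
        filter_upwards [hzD] with w hw using hke w hw))
      have h4 := DFunLike.congr_fun h3 X
      have hLX : L X ≠ 0 := fun h => hq0 z hz (by rw [hqz, h, mul_zero])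
      simp only [smul_apply, smul_eq_mul, hkz, one_mul, hqz] at h4
      exact mul_right_cancel₀ hLX (by linear_combination -h4)
    have hfd := ((hasDerivAt_inv (hne z hz)).comp_hasFDerivAt z
      ((hkd.sub_const (k z)).sub_const (2 * Real.pi * I))
      |>.sub_const ((-(2 * Real.pi * I) : ℂ)⁻¹)).const_mul (1 / 8 : ℂ)
    have hkX : ‖fderiv ℂ k z X‖ = ‖x‖⁻¹ := by
      rw [eq_div_of_mul_eq hx hder]
      simp
    have hfd' : fderiv ℂ (fun w => 1 / 8 * ((k w - k z - 2 * Real.pi * I)⁻¹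
        - (-(2 * Real.pi * I) : ℂ)⁻¹)) z = _ := hfd.fderiv
    rw [hfd']
    simp [hkX]
    rw [abs_of_pos Real.pi_pos]
    have := Real.pi_pos
    field_simp
    norm_num

/-- There is no continuous logarithm of a nonzero multiple of the conjugation on the circle. -/
lemma not_exists_circle_log (s : ℂ) :
    ¬ ∃ k : Circle → ℂ, Continuous k ∧ ∀ m, exp (k m) = s * (m⁻¹ : Circle) := by
  rintro ⟨k, hk, hke⟩
  have h := eq_of_exp_eq_const (f := fun t : ℝ => k (Circle.exp t) + t * I) (c := s)
    (by fun_prop) (fun t => by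
      rw [exp_add, hke, ← Circle.coe_exp, mul_assoc, ← Circle.coe_mul, inv_mul_cancel,
        Circle.coe_one, mul_one]) (2 * Real.pi) 0
  simp at h

/-- At a differentiable boundary point of a ℂ-convex open set, the complex tangent hyperplane
does not meet the set. -/
lemma IsCConvex.add_notMem_of_tangent {n : ℕ} {D : Set (Cn n)} (hD : IsCConvex D)
    (hDo : IsOpen D) {b : Cn n} (hb : b ∉ D) {r : Cn n → ℝ} {T : Cn n →L[ℝ] ℝ}
    (hr : HasFDerivAt r T b) (hrb : r b = 0) (hT : T ≠ 0)
    (hloc : ∀ᶠ x in nhds b, r x < 0 → x ∈ D) {v : Cn n} (hv : ∀ c : ℂ, T (c • v) = 0) :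
    b + v ∉ D := by
  intro hbv
  obtain ⟨ν, hν⟩ : ∃ ν, T ν < 0 := by
    obtain ⟨w, hw⟩ := DFunLike.ne_iff.1 hT
    rcases lt_or_gt_of_ne hw with h | h
    · exact ⟨w, h⟩
    · exact ⟨-w, by simpa using h⟩
  obtain ⟨ε, hε, hεD⟩ : ∃ ε > (0 : ℝ), ∀ m : Circle, b + (v + ((ε : ℂ) * m) • ν) ∈ D := by
    have hc : ContinuousAt (fun m : ℂ => b + (v + m • ν)) 0 := by fun_prop
    obtain ⟨δ, hδ, h⟩ := Metric.eventually_nhds_iff_ball.1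
      (hc.eventually (hDo.mem_nhds (by simpa using hbv)))
    refine ⟨δ / 2, by positivity, fun m => h _ ?_⟩
    rw [mem_ball_zero_iff, norm_mul, norm_real, Circle.norm_coe,
      Real.norm_of_nonneg (by positivity)]
    linarith
  set y : Circle → Cn n := fun m => ((ε : ℂ) * (m⁻¹ : Circle)) • (v + ((ε : ℂ) * m) • ν) with hy
  have hy' : ∀ m, y m = ((ε : ℂ) * (m⁻¹ : Circle)) • v + (ε ^ 2) • ν := by
    intro m
    have hm : ((m⁻¹ : Circle) : ℂ) * m = 1 := by
      rw [← Circle.coe_mul, inv_mul_cancel, Circle.coe_one]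
    simp only [hy, smul_add, smul_smul]
    congr 1
    rw [← Complex.coe_smul]
    congr 1
    rw [ofReal_pow]
    linear_combination (ε : ℂ) ^ 2 * hm
  have hTy : ∀ m, T (y m) = ε ^ 2 * T ν := by
    intro m
    rw [hy', map_add, hv, zero_add, map_smul, smul_eq_mul]
  set M := ε * ‖v‖ + ε ^ 2 * ‖ν‖ + 1 with hM
  have hM0 : 0 < M := by positivity
  have hyM : ∀ m, ‖y m‖ ≤ M := by
    intro m
    rw [hy']
    refine (norm_add_le _ _).trans ?_
    rw [norm_smul, norm_smul, norm_mul, norm_real, Circle.norm_coe, Real.norm_of_nonneg hε.le,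
      Real.norm_of_nonneg (by positivity)]
    linarith
  obtain ⟨s, hs, hsD⟩ : ∃ s > (0 : ℝ), ∀ m, b + s • y m ∈ D := by
    set η := ε ^ 2 * (-T ν) / (2 * M) with hη
    have hη0 : 0 < η := by
      have : 0 < -T ν := by linarith
      positivity
    have h1 := (hasFDerivAt_iff_isLittleO_nhds_zero.1 hr).def hη0
    have hc : ContinuousAt (fun h : Cn n => b + h) 0 := by fun_prop
    have h2 := hc.eventually (p := fun x => r x < 0 → x ∈ D) (by simpa using hloc)
    obtain ⟨δ, hδ, h⟩ := Metric.eventually_nhds_iff_ball.1 (h1.and h2)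
    refine ⟨δ / (2 * M), by positivity, fun m => ?_⟩
    set s := δ / (2 * M) with hs
    have hs0 : 0 < s := by positivity
    have hsy : ‖s • y m‖ ≤ s * M := by
      rw [norm_smul, Real.norm_of_nonneg hs0.le]
      exact mul_le_mul_of_nonneg_left (hyM m) hs0.le
    have hsM : s * M = δ / 2 := by
      rw [hs]
      field_simp
    obtain ⟨h3, h4⟩ := h (s • y m) (by
      rw [mem_ball_zero_iff]
      linarith)
    refine h4 ?_
    rw [hrb, map_smul, hTy, Real.norm_eq_abs, smul_eq_mul] at h3
    have h5 := (abs_le.1 h3).2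
    have h6 : η * ‖s • y m‖ ≤ η * (s * M) := mul_le_mul_of_nonneg_left hsy hη0.le
    have h7 : η * (s * M) = s * (ε ^ 2 * (-T ν)) / 2 := by
      rw [hη]
      field_simp
    have h8 : 0 < s * (ε ^ 2 * (-T ν)) := by
      have : 0 < -T ν := by linarith
      positivity
    linarith
  obtain ⟨g, hg⟩ : ∃ g : Circle × ℂ → ℂ, ∀ m x,
      g (m, x) = 1 + x * ((s : ℂ) * (ε * (m⁻¹ : Circle)) - 1) :=
    ⟨fun p => 1 + p.2 * ((s : ℂ) * (ε * (p.1⁻¹ : Circle)) - 1), fun _ _ => rfl⟩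
  have hgc : Continuous g := by
    have : Continuous fun p : Circle × ℂ => 1 + p.2 * ((s : ℂ) * (ε * (p.1⁻¹ : Circle)) - 1) := by
      fun_prop
    exact this.congr fun ⟨m, x⟩ => (hg m x).symm
  obtain ⟨W, hW⟩ : ∃ W : Set (Circle × ℂ), ∀ p, p ∈ W ↔
      b + g p • (v + ((ε : ℂ) * p.1) • ν) ∈ D := ⟨{p | _}, fun _ => Iff.rfl⟩
  have hWo : IsOpen W := by
    have : Continuous fun p : Circle × ℂ => b + g p • (v + ((ε : ℂ) * p.1) • ν) := by fun_prop
    convert hDo.preimage this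
    ext p
    exact hW p
  have hline : ∀ (m : Circle) (x : ℂ), (m, x) ∈ W ↔ b + (v + ((ε : ℂ) * m) • ν) +
      x • (((s : ℂ) * (ε * (m⁻¹ : Circle)) - 1) • (v + ((ε : ℂ) * m) • ν)) ∈ D := by
    intro m x
    rw [hW, hg, smul_smul, add_smul, one_smul, add_assoc b]
  have h0 : ∀ m : Circle, (m, (0 : ℂ)) ∈ W := fun m => by
    rw [hline]
    simpa using hεD m
  have h1 : ∀ m : Circle, (m, (1 : ℂ)) ∈ W := fun m => by
    rw [hW, hg, one_mul, add_sub_cancel, mul_smul]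
    simpa [hy] using hsD m
  obtain ⟨k, hk, hke⟩ := exists_continuous_log_increment hWo
    (fun m => by
      simp only [hline]
      exact hD.isSimplyConnected_slice _ _ ⟨0, by simpa using hεD m⟩) h0 h1 hgc.continuousOn
    (fun p hp h => hb (by simpa [h] using (hW p).1 hp))
  refine not_exists_circle_log (s * ε) ⟨k, hk, fun m => ?_⟩
  have := hke m
  rw [hg, hg] at this
  linear_combination this

/-- The Carathéodory–Kobayashi comparison on admissible competitors, from the Schwarz lemma. -/
lemma norm_fderiv_le_of_disc {n : ℕ} {D : Set (Cn n)} (hDo : IsOpen D) {z X : Cn n}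
    {f : Cn n → ℂ} (hf : DifferentiableOn ℂ f D) (hfD : MapsTo f D (ball (0 : ℂ) 1))
    (hfz : f z = 0) {α : ℝ} (hα : 0 ≤ α) {φ : ℂ → Cn n}
    (hφ : DifferentiableOn ℂ φ (ball (0 : ℂ) 1)) (hφD : MapsTo φ (ball (0 : ℂ) 1) D)
    (hφ0 : φ 0 = z) (hφX : α • fderiv ℂ φ 0 1 = X) : ‖fderiv ℂ f z X‖ ≤ α := by
  have h0 : (0 : ℂ) ∈ ball (0 : ℂ) 1 := mem_ball_self one_pos
  have hz : φ 0 ∈ D := hφD h0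
  have hcomp : fderiv ℂ (f ∘ φ) 0 = (fderiv ℂ f (φ 0)).comp (fderiv ℂ φ 0) :=
    fderiv_comp _ (hf.differentiableAt (hDo.mem_nhds hz))
      (hφ.differentiableAt (isOpen_ball.mem_nhds h0))
  have hS : ‖fderiv ℂ (f ∘ φ) 0‖ ≤ 1 := by
    refine norm_fderiv_le_one_of_mapsTo_ball (R := 1) (hf.comp hφ hφD) ?_ one_pos
    have : (f ∘ φ) 0 = 0 := by simp [hφ0, hfz]
    rw [this]
    exact (hfD.comp hφD).mono_right ball_subset_closedBall
  have h1 := ContinuousLinearMap.le_of_opNorm_le _ hS 1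
  rw [hcomp, ContinuousLinearMap.comp_apply, hφ0, norm_one, mul_one] at h1
  rw [← hφX, ← Complex.coe_smul, map_smul, norm_smul, norm_real, Real.norm_of_nonneg hα]
  exact mul_le_of_le_one_right hα h1

/-- A linear disc is a competitor in the definition of the Kobayashi metric. -/
lemma linear_disc_mem {n : ℕ} {D : Set (Cn n)} {z X : Cn n} {ρ : ℝ} (hρ : 0 < ρ)
    (h : ∀ y : ℂ, ‖y‖ < ρ → z + y • X ∈ D) :
    ρ⁻¹ ∈ {a : ℝ | 0 ≤ a ∧ ∃ φ : ℂ → Cn n, DifferentiableOn ℂ φ (ball (0:ℂ) 1) ∧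
      MapsTo φ (ball (0:ℂ) 1) D ∧ φ 0 = z ∧ a • (fderiv ℂ φ 0 1) = X} := by
  refine ⟨by positivity, fun y => z + y • (ρ • X), by fun_prop, fun y hy => ?_, by simp, ?_⟩
  · have := h (y * ρ) (by
      rw [norm_mul, norm_real, Real.norm_of_nonneg hρ.le]
      exact mul_lt_of_lt_one_left hρ (by simpa using hy))
    simpa [mul_smul] using this
  · have hd : HasFDerivAt (fun y : ℂ => z + y • (ρ • X))
        ((ContinuousLinearMap.id ℂ ℂ).smulRight (ρ • X)) 0 :=
      ((ContinuousLinearMap.id ℂ ℂ).smulRight (ρ • X)).hasFDerivAt.const_add z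
    rw [hd.fderiv]
    simp [smul_smul, inv_mul_cancel₀ hρ.ne']

lemma kobMetric_le_of_linear_disc {n : ℕ} {D : Set (Cn n)} {z X : Cn n} {ρ : ℝ} (hρ : 0 < ρ)
    (h : ∀ y : ℂ, ‖y‖ < ρ → z + y • X ∈ D) : kobMetric D z X ≤ ρ⁻¹ :=
  csInf_le ⟨0, fun _ ha => ha.1⟩ (linear_disc_mem hρ h)

lemma caraMetric_le_kobMetric {n : ℕ} {D : Set (Cn n)} (hDo : IsOpen D) {z X : Cn n}
    {ρ : ℝ} (hρ : 0 < ρ) (h : ∀ y : ℂ, ‖y‖ < ρ → z + y • X ∈ D) :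
    caraMetric D z X ≤ kobMetric D z X := by
  refine csSup_le ⟨0, 0, differentiableOn_const _, fun _ _ => by simp, rfl, ?_⟩ ?_
  · rw [fderiv_zero]
    simp
  · rintro _ ⟨f, hf, hfD, hfz, rfl⟩
    refine le_csInf ⟨_, linear_disc_mem hρ h⟩ ?_
    rintro α ⟨hα, φ, hφ, hφD, hφ0, hφX⟩
    exact norm_fderiv_le_of_disc hDo hf hfD hfz hα hφ hφD hφ0 hφX

lemma le_caraMetric {n : ℕ} {D : Set (Cn n)} (hDo : IsOpen D) {z X : Cn n}
    {ρ : ℝ} (hρ : 0 < ρ) (h : ∀ y : ℂ, ‖y‖ < ρ → z + y • X ∈ D) {f : Cn n → ℂ}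
    (hf : DifferentiableOn ℂ f D) (hfD : MapsTo f D (ball (0 : ℂ) 1)) (hfz : f z = 0) :
    ‖fderiv ℂ f z X‖ ≤ caraMetric D z X := by
  refine le_csSup ⟨ρ⁻¹, ?_⟩ ⟨f, hf, hfD, hfz, rfl⟩
  rintro _ ⟨f, hf, hfD, hfz, rfl⟩
  obtain ⟨hα, φ, hφ, hφD, hφ0, hφX⟩ := linear_disc_mem hρ h
  exact norm_fderiv_le_of_disc hDo hf hfD hfz hα hφ hφD hφ0 hφX

universe u

open scoped ContDiff Nat in
/-- Taylor's formula for a smooth map whose derivatives of order less than `n` vanish. -/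
lemma exists_norm_sub_taylor_le {E : Type u} [NormedAddCommGroup E] [NormedSpace ℝ E] (n : ℕ) :
    ∀ {F : Type u} [NormedAddCommGroup F] [NormedSpace ℝ F] {f : E → F},
      ContDiffAt ℝ ∞ f 0 → (∀ k < n, iteratedFDeriv ℝ k f 0 = 0) →
      ∃ C : ℝ, ∀ᶠ x in nhds 0,
        ‖f x - (n ! : ℝ)⁻¹ • iteratedFDeriv ℝ n f 0 (fun _ => x)‖ ≤ C * ‖x‖ ^ (n + 1) := by
  induction n with
  | zero =>
    intro F _ _ f hf _
    have := (hf.differentiableAt (by simp)).hasFDerivAt.isBigO_sub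
    obtain ⟨C, hC⟩ := this.bound
    exact ⟨C, hC.mono fun x hx => by simpa using hx⟩
  | succ n ih =>
    intro F _ _ f hf h0
    have hf' : ContDiffAt ℝ ∞ (fderiv ℝ f) 0 := hf.fderiv_right (by simp)
    obtain ⟨C, hC⟩ := ih hf' (fun k hk => by
      have := h0 (k + 1) (by omega)
      rw [← norm_eq_zero] at this ⊢
      rwa [norm_iteratedFDeriv_fderiv])
    have hd : ∀ᶠ x in nhds (0 : E), DifferentiableAt ℝ f x :=
      ((hf.of_le (m := 1) (by simp)).eventually (by simp)).mono
        fun x hx => hx.differentiableAt (by simp)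
    obtain ⟨δ, hδ, h⟩ := Metric.eventually_nhds_iff_ball.1 (hC.and hd)
    refine ⟨C, Metric.eventually_nhds_iff_ball.2 ⟨δ, hδ, fun x hx => ?_⟩⟩
    set T := iteratedFDeriv ℝ (n + 1) f 0 with hT
    have hφ : ∀ t ∈ Icc (0 : ℝ) 1, HasDerivWithinAt
        (fun t : ℝ => f (t • x) - (((n + 1)! : ℝ)⁻¹ * t ^ (n + 1)) • T (fun _ => x))
        (fderiv ℝ f (t • x) x - ((n ! : ℝ)⁻¹ * t ^ n) • T (fun _ => x)) (Icc 0 1) t := by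
      intro t ht
      have hball : t • x ∈ ball (0 : E) δ := by
        rw [mem_ball_zero_iff] at hx ⊢
        rw [norm_smul, Real.norm_of_nonneg ht.1]
        exact (mul_le_of_le_one_left (norm_nonneg _) ht.2).trans_lt hx
      have h1 : HasDerivAt (fun t : ℝ => f (t • x)) (fderiv ℝ f (t • x) x) t := by
        have := (h _ hball).2.hasFDerivAt.comp_hasDerivAt t ((hasDerivAt_id t).smul_const x)
        simpa [Function.comp_def] using this
      have h2 : HasDerivAt (fun t : ℝ => (((n + 1)! : ℝ)⁻¹ * t ^ (n + 1)) • T (fun _ => x))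
          (((n ! : ℝ)⁻¹ * t ^ n) • T (fun _ => x)) t := by
        refine HasDerivAt.smul_const ?_ _
        convert (hasDerivAt_pow (n + 1) t).const_mul ((n + 1)! : ℝ)⁻¹ using 1
        rw [Nat.factorial_succ]
        push_cast
        have := Nat.cast_ne_zero (R := ℝ).2 n.factorial_ne_zero
        field_simp
      exact (h1.sub h2).hasDerivWithinAt
    have hbd : ∀ t ∈ Ico (0 : ℝ) 1,
        ‖fderiv ℝ f (t • x) x - ((n ! : ℝ)⁻¹ * t ^ n) • T (fun _ => x)‖ ≤
          C * ‖x‖ ^ (n + 1 + 1) := by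
      intro t ht
      have hball : t • x ∈ ball (0 : E) δ := by
        rw [mem_ball_zero_iff] at hx ⊢
        rw [norm_smul, Real.norm_of_nonneg ht.1]
        exact (mul_le_of_le_one_left (norm_nonneg _) ht.2.le).trans_lt hx
      have h1 := (h _ hball).1
      have h2 : fderiv ℝ f (t • x) x - ((n ! : ℝ)⁻¹ * t ^ n) • T (fun _ => x) =
          (fderiv ℝ f (t • x) - (n ! : ℝ)⁻¹ •
            iteratedFDeriv ℝ n (fderiv ℝ f) 0 (fun _ => t • x)) x := by
        have h3 : iteratedFDeriv ℝ n (fderiv ℝ f) 0 (fun _ => t • x) =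
            t ^ n • iteratedFDeriv ℝ n (fderiv ℝ f) 0 (fun _ => x) := by
          simpa using (iteratedFDeriv ℝ n (fderiv ℝ f) 0).map_smul_univ (fun _ => t) (fun _ => x)
        rw [h3, hT, iteratedFDeriv_succ_apply_right, smul_smul]
        rfl
      rw [h2]
      refine (ContinuousLinearMap.le_opNorm _ _).trans ?_
      rw [pow_succ _ (n + 1), ← mul_assoc]
      refine mul_le_mul_of_nonneg_right (h1.trans ?_) (norm_nonneg _)
      rcases (norm_nonneg x).eq_or_lt with h4 | h4
      · simp [← h4, norm_smul]
      have hC0 : 0 ≤ C := by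
        have h5 := (h x hx).1
        exact nonneg_of_mul_nonneg_left ((norm_nonneg _).trans h5) (by positivity)
      rw [norm_smul, Real.norm_of_nonneg ht.1]
      refine mul_le_mul_of_nonneg_left (pow_le_pow_left₀ (mul_nonneg ht.1 (norm_nonneg _))
        (mul_le_of_le_one_left (norm_nonneg _) ht.2.le) _) hC0
    have := norm_image_sub_le_of_norm_deriv_le_segment' hφ hbd 1 (by simp)
    have hf0 : f 0 = 0 := by
      have h3 := h0 0 (by omega)
      have h4 := congrArg (fun M => M 0) h3
      simpa using h4
    simpa [hf0] using this

open scoped ContDiff in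
/-- Linear identities satisfied by a smooth map pass to its iterated derivatives. -/
lemma map_iteratedFDeriv_eq_of_comp_eq {E G : Type*} [NormedAddCommGroup E] [NormedSpace ℝ E]
    [NormedAddCommGroup G] [NormedSpace ℝ G] (A : G →L[ℝ] G) {g : E → G} {x : E}
    (hg : ContDiffAt ℝ ∞ g x) (hA : A ∘ g =ᶠ[nhds x] g) (n : ℕ) (m : Fin n → E) :
    A (iteratedFDeriv ℝ n g x m) = iteratedFDeriv ℝ n g x m := by
  have h := (hA.iteratedFDeriv ℝ n).eq_of_nhds
  rw [A.iteratedFDeriv_comp_left (contDiffAt_infty.1 hg n) le_rfl] at h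
  exact congrArg (fun M => M m) h

open scoped ContDiff in
/-- Iterated derivatives of a smooth map are invariant under adjacent transpositions. -/
lemma iteratedFDeriv_comp_adjacent_swap {E : Type u} [NormedAddCommGroup E] [NormedSpace ℝ E]
    (n : ℕ) : ∀ {F : Type u} [NormedAddCommGroup F] [NormedSpace ℝ F] {f : E → F} {x : E},
      ContDiffAt ℝ ∞ f x → ∀ (i : Fin n) (v : Fin (n + 1) → E),
      iteratedFDeriv ℝ (n + 1) f x (v ∘ Equiv.swap i.castSucc i.succ) =
        iteratedFDeriv ℝ (n + 1) f x v := by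
  induction n with
  | zero => exact fun _ i => i.elim0
  | succ n ih =>
    intro F _ _ f x hf i v
    have hf' : ContDiffAt ℝ ∞ (fderiv ℝ f) x := hf.fderiv_right (by simp)
    induction i using Fin.lastCases with
    | cast i =>
      rw [iteratedFDeriv_succ_apply_right, iteratedFDeriv_succ_apply_right (m := v)]
      have h1 : (v ∘ Equiv.swap i.castSucc.castSucc i.castSucc.succ) (Fin.last (n + 1)) =
          v (Fin.last (n + 1)) := by
        rw [Function.comp_apply, Equiv.swap_apply_of_ne_of_ne]
        · exact (Fin.castSucc_lt_last _).ne'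
        · rw [Fin.succ_castSucc]
          exact (Fin.castSucc_lt_last _).ne'
      have h2 : Fin.init (v ∘ Equiv.swap i.castSucc.castSucc i.castSucc.succ) =
          Fin.init v ∘ Equiv.swap i.castSucc i.succ := by
        ext j
        simp only [Fin.init, Function.comp_apply, Fin.succ_castSucc]
        rw [(Fin.castSucc_injective _).map_swap]
      rw [h1, h2]
      exact congrArg (fun A : E →L[ℝ] F => A _) (ih hf' i (Fin.init v))
    | last =>
      have hf'' : ContDiffAt ℝ ∞ (fderiv ℝ (fderiv ℝ f)) x := hf'.fderiv_right (by simp)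
      obtain ⟨A, hA⟩ : ∃ A : (E →L[ℝ] E →L[ℝ] F) →L[ℝ] (E →L[ℝ] E →L[ℝ] F),
          ∀ B u w, A B u w = B w u :=
        ⟨(ContinuousLinearMap.flipₗᵢ ℝ E E F).toContinuousLinearEquiv.toContinuousLinearMap,
          fun _ _ _ => rfl⟩
      have hsymm : A ∘ fderiv ℝ (fderiv ℝ f) =ᶠ[nhds x] fderiv ℝ (fderiv ℝ f) := by
        filter_upwards [(contDiffAt_infty.1 hf 2).eventually (by simp)]
          with y hy
        ext u w
        rw [Function.comp_apply, hA]
        exact hy.isSymmSndFDerivAt (by simp) w u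
      have h2 : ∀ m u w, iteratedFDeriv ℝ n (fderiv ℝ (fderiv ℝ f)) x m u w =
          iteratedFDeriv ℝ n (fderiv ℝ (fderiv ℝ f)) x m w u := by
        intro m u w
        conv_lhs => rw [← map_iteratedFDeriv_eq_of_comp_eq (G := E →L[ℝ] E →L[ℝ] F) A hf'' hsymm]
        exact hA _ _ _
      have h3 : ∀ m, iteratedFDeriv ℝ (n + 1 + 1) f x m =
          iteratedFDeriv ℝ n (fderiv ℝ (fderiv ℝ f)) x (Fin.init (Fin.init m))
            (m (Fin.last n).castSucc) (m (Fin.last (n + 1))) := by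
        intro m
        rw [iteratedFDeriv_succ_apply_right, iteratedFDeriv_succ_apply_right]
        rfl
      rw [h3, h3, h2]
      have h4 : Fin.init (Fin.init (v ∘ Equiv.swap (Fin.last n).castSucc (Fin.last n).succ)) =
          Fin.init (Fin.init v) := by
        ext j
        simp only [Fin.init, Function.comp_apply]
        rw [Equiv.swap_apply_of_ne_of_ne]
        · exact (Fin.castSucc_injective _).ne (Fin.castSucc_lt_last _).ne
        · rw [Fin.succ_last]
          exact (Fin.castSucc_lt_last _).ne
      rw [h4, ← Fin.succ_last, Function.comp_apply, Function.comp_apply,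
        Equiv.swap_apply_left, Equiv.swap_apply_right]

open scoped ContDiff in
lemma iteratedFDeriv_comp_perm {E F : Type u} [NormedAddCommGroup E] [NormedSpace ℝ E]
    [NormedAddCommGroup F] [NormedSpace ℝ F] {f : E → F} {x : E} (hf : ContDiffAt ℝ ∞ f x)
    (n : ℕ) (v : Fin n → E) (σ : Equiv.Perm (Fin n)) :
    iteratedFDeriv ℝ n f x (v ∘ σ) = iteratedFDeriv ℝ n f x v := by
  cases n with
  | zero => rw [Subsingleton.elim (v ∘ σ) v]
  | succ n =>
    have hσ : σ ∈ Submonoid.closure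
        (Set.range fun i : Fin n => Equiv.swap i.castSucc i.succ) := by
      rw [Equiv.Perm.mclosure_swap_castSucc_succ]
      trivial
    induction hσ using Submonoid.closure_induction generalizing v with
    | mem σ h =>
      obtain ⟨i, rfl⟩ := h
      exact iteratedFDeriv_comp_adjacent_swap n hf i v
    | one => rfl
    | mul σ τ _ _ h1 h2 =>
      rw [Equiv.Perm.coe_mul, ← Function.comp_assoc, h2, h1]

open scoped ContDiff in
/-- A nonzero iterated derivative is nonzero on some diagonal vector. -/
lemma exists_iteratedFDeriv_diag_ne_zero {E F : Type u} [NormedAddCommGroup E] [NormedSpace ℝ E]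
    [NormedAddCommGroup F] [NormedSpace ℝ F] {f : E → F} {x : E} (hf : ContDiffAt ℝ ∞ f x)
    {n : ℕ} (hn : iteratedFDeriv ℝ n f x ≠ 0) :
    ∃ e : E, iteratedFDeriv ℝ n f x (fun _ => e) ≠ 0 := by
  by_contra! h
  refine hn (ContinuousMultilinearMap.ext fun v => ?_)
  have h1 := (iteratedFDeriv ℝ n f x).iteratedFDeriv_comp_diagonal 0 v
  have h2 : ∀ σ : Equiv.Perm (Fin n), iteratedFDeriv ℝ n f x (fun i => v (σ i)) =
      iteratedFDeriv ℝ n f x v := iteratedFDeriv_comp_perm hf n v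
  simp only [h, h2] at h1
  rw [Finset.sum_const] at h1
  have h3 : iteratedFDeriv ℝ n (fun _ : E => (0 : F)) 0 v = 0 := by
    simp
  rw [h3, eq_comm, ← Nat.cast_smul_eq_nsmul ℝ, smul_eq_zero] at h1
  exact h1.resolve_left (by simp [Fintype.card_perm, Nat.factorial_ne_zero])

open scoped ContDiff Nat in
/-- A real function on `ℂ` vanishing to order exactly `l` at the origin is `O(|w|^l)` and has
size comparable to `s^l` along some ray, where it can be taken positive if `l = 1`. -/
lemma exists_order_bounds {h : ℂ → ℝ} (hh : ContDiffAt ℝ ∞ h 0) {l : ℕ}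
    (hlow : ∀ k < l, iteratedFDeriv ℝ k h 0 = 0) (hord : iteratedFDeriv ℝ l h 0 ≠ 0) :
    (∃ K > 0, ∀ᶠ w in nhds 0, |h w| ≤ K * ‖w‖ ^ l) ∧
      ∃ e : ℂ, ∃ k > 0, (∀ᶠ s in nhdsWithin (0 : ℝ) (Ioi 0), k * s ^ l ≤ h (s • e)) ∨
        (l ≠ 1 ∧ ∀ᶠ s in nhdsWithin (0 : ℝ) (Ioi 0), h (s • e) ≤ -(k * s ^ l)) := by
  set T := iteratedFDeriv ℝ l h 0 with hT
  obtain ⟨C, hC⟩ := exists_norm_sub_taylor_le l hh hlow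
  rw [← hT] at hC
  have hl : (0 : ℝ) < l ! := by exact_mod_cast l.factorial_pos
  refine ⟨⟨(l ! : ℝ)⁻¹ * ‖T‖ + |C| + 1, by positivity, ?_⟩, ?_⟩
  · filter_upwards [hC, Metric.ball_mem_nhds (0 : ℂ) one_pos] with w hw hw1
    have h1 : ‖T fun _ => w‖ ≤ ‖T‖ * ‖w‖ ^ l := by
      simpa using T.le_opNorm (fun _ => w)
    have h2 : ‖h w‖ ≤ ‖(l ! : ℝ)⁻¹ • T fun _ => w‖ + C * ‖w‖ ^ (l + 1) := by
      have := norm_add_le (h w - (l ! : ℝ)⁻¹ • T fun _ => w) ((l ! : ℝ)⁻¹ • T fun _ => w)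
      rw [sub_add_cancel] at this
      linarith
    have h3 : C * ‖w‖ ^ (l + 1) ≤ |C| * ‖w‖ ^ l := by
      rw [mem_ball_zero_iff] at hw1
      exact mul_le_mul (le_abs_self C) (pow_le_pow_of_le_one (norm_nonneg _) hw1.le (by simp))
        (by positivity) (abs_nonneg C)
    have h4 : ‖(l ! : ℝ)⁻¹ • T fun _ => w‖ ≤ (l ! : ℝ)⁻¹ * (‖T‖ * ‖w‖ ^ l) := by
      rw [norm_smul, Real.norm_of_nonneg (by positivity)]
      gcongr
    have h5 : 0 ≤ ‖w‖ ^ l := by positivity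
    rw [← Real.norm_eq_abs]
    nlinarith
  · have key : ∀ e : ℂ, ∀ᶠ s in nhdsWithin (0 : ℝ) (Ioi 0), T (fun _ => e) ≠ 0 →
        |h (s • e) - (l ! : ℝ)⁻¹ * T (fun _ => e) * s ^ l| ≤
          (2 * l ! : ℝ)⁻¹ * |T (fun _ => e)| * s ^ l := by
      intro e
      by_cases he : T (fun _ => e) = 0
      · simp [he]
      have hc : Filter.Tendsto (fun s : ℝ => s • e) (nhdsWithin 0 (Ioi 0)) (nhds 0) := by
        have : ContinuousAt (fun s : ℝ => s • e) 0 := by fun_prop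
        simpa using this.tendsto.mono_left nhdsWithin_le_nhds
      have hc2 : Filter.Tendsto (fun s : ℝ => C * ‖e‖ ^ (l + 1) * s) (nhdsWithin 0 (Ioi 0))
          (nhds 0) := by
        have : ContinuousAt (fun s : ℝ => C * ‖e‖ ^ (l + 1) * s) 0 := by fun_prop
        simpa using this.tendsto.mono_left nhdsWithin_le_nhds
      have hpos : 0 < (2 * l ! : ℝ)⁻¹ * |T (fun _ => e)| := by positivity
      filter_upwards [hc.eventually hC, hc2.eventually_le_const hpos, self_mem_nhdsWithin]
        with s hs hs2 hs0 _
      rw [mem_Ioi] at hs0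
      have h1 : T (fun _ => s • e) = s ^ l * T (fun _ => e) := by
        simpa using T.map_smul_univ (fun _ => s) (fun _ => e)
      rw [h1, norm_smul, Real.norm_of_nonneg hs0.le, smul_eq_mul, Real.norm_eq_abs] at hs
      have h2 : C * (s * ‖e‖) ^ (l + 1) = C * ‖e‖ ^ (l + 1) * s * s ^ l := by ring
      rw [h2] at hs
      have h3 := mul_le_mul_of_nonneg_right hs2 (pow_nonneg hs0.le l)
      have h4 : (l ! : ℝ)⁻¹ * T (fun _ => e) * s ^ l =
        (l ! : ℝ)⁻¹ * (s ^ l * T (fun _ => e)) := by ring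
      rw [h4]
      linarith
    have hpos : ∀ e : ℂ, 0 < T (fun _ => e) →
        ∃ k > 0, ∀ᶠ s in nhdsWithin (0 : ℝ) (Ioi 0), k * s ^ l ≤ h (s • e) := by
      intro e he
      refine ⟨(2 * l ! : ℝ)⁻¹ * T (fun _ => e), by positivity, (key e).mono fun s hs => ?_⟩
      have := (abs_le.1 (hs he.ne')).1
      rw [abs_of_pos he] at this
      have h2 : (l ! : ℝ)⁻¹ = 2 * (2 * l ! : ℝ)⁻¹ := by field_simp
      rw [h2] at this
      linarith
    obtain ⟨e, he⟩ := exists_iteratedFDeriv_diag_ne_zero hh hord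
    rw [← hT] at he
    rcases lt_or_gt_of_ne he with he | he
    · by_cases hl1 : l = 1
      · subst hl1
        have : 0 < T (fun _ => -e) := by
          have h1 : T (fun _ => -e) = -T (fun _ => e) := by
            simpa using T.map_smul_univ (fun _ => (-1 : ℝ)) (fun _ => e)
          linarith
        obtain ⟨k, hk, h⟩ := hpos _ this
        exact ⟨-e, k, hk, Or.inl h⟩
      · have he' : 0 < -T (fun _ => e) := by linarith
        refine ⟨e, (2 * l ! : ℝ)⁻¹ * -T (fun _ => e), by positivity, Or.inr ⟨hl1, ?_⟩⟩
        refine (key e).mono fun s hs => ?_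
        have := (abs_le.1 (hs he.ne)).2
        rw [abs_of_neg he] at this
        have h2 : (l ! : ℝ)⁻¹ = 2 * (2 * l ! : ℝ)⁻¹ := by field_simp
        rw [h2] at this
        linarith
    · obtain ⟨k, hk, h⟩ := hpos _ he
      exact ⟨e, k, hk, Or.inl h⟩

/-- Lower bound for the Carathéodory metric by the distance to the complement along the
direction, near a smooth piece of the boundary. -/
lemma IsCConvex.le_caraMetric_of_notMem {n : ℕ} {D : Set (Cn n)} (hcc : IsCConvex D)
    (hDo : IsOpen D) {U : Set (Cn n)} (hU : IsOpen U) {r : Cn n → ℝ}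
    (hr : ∀ x ∈ U, DifferentiableAt ℝ r x) (hgrad : ∀ x ∈ U, fderiv ℝ r x ≠ 0)
    (hsub : D ∩ U = {x ∈ U | r x < 0}) (hbd : frontier D ∩ U = {x ∈ U | r x = 0})
    {z X : Cn n} (hz : z ∈ D) {y : ℂ} (hy : z + y • X ∉ D)
    (hyU : ∀ x : ℂ, ‖x‖ ≤ ‖y‖ → z + x • X ∈ U) {ρ : ℝ} (hρ : 0 < ρ)
    (hdisc : ∀ x : ℂ, ‖x‖ < ρ → z + x • X ∈ D) :
    (32 * Real.pi ^ 2 * ‖y‖)⁻¹ ≤ caraMetric D z X := by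
  have hcont : Continuous fun x : ℂ => z + x • X := by fun_prop
  have hS : IsCompact (closedBall (0 : ℂ) ‖y‖ ∩ (fun x : ℂ => z + x • X) ⁻¹' Dᶜ) :=
    (isCompact_closedBall _ _).inter_right (hDo.isClosed_compl.preimage hcont)
  obtain ⟨x, ⟨hxy, hxD⟩, hmin⟩ := hS.exists_isMinOn ⟨y, by simp, hy⟩ continuous_norm.continuousOn
  rw [mem_closedBall_zero_iff] at hxy
  have hx0 : x ≠ 0 := by
    rintro rfl
    exact hxD (by simpa using hz)
  have hdx : ∀ y : ℂ, ‖y‖ < ‖x‖ → z + y • X ∈ D := by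
    intro w hw
    by_contra hwD
    exact absurd (hmin ⟨mem_closedBall_zero_iff.2 (hw.le.trans hxy), hwD⟩) (not_le.2 hw)
  set b := z + x • X with hb
  have hbU : b ∈ U := hyU x hxy
  have hbfr : b ∈ frontier D := by
    rw [hDo.frontier_eq]
    refine ⟨?_, hxD⟩
    have hx : x ∈ closure (ball (0 : ℂ) ‖x‖) := by
      rw [closure_ball _ (norm_ne_zero_iff.2 hx0)]
      simp
    exact map_mem_closure (f := fun x : ℂ => z + x • X) hcont hx
      fun w hw => hdx w (mem_ball_zero_iff.1 hw)
  have hrb : r b = 0 := (hbd.subset ⟨hbfr, hbU⟩).2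
  set T := fderiv ℝ r b with hT
  obtain ⟨L, hL⟩ : ∃ L : Cn n →L[ℂ] ℂ, ∀ v, (L v).re = T v :=
    ⟨StrongDual.extendRCLike (𝕜 := ℂ) T, fun v => by
      rw [← RCLike.re_eq_complex_re, StrongDual.re_extendRCLike_apply]⟩
  obtain ⟨f, hf, hfD, hfz, hfX⟩ := hcc.exists_caratheodory_candidate hDo hz hx0 hdx L (by
    intro w hw hLw
    refine hcc.add_notMem_of_tangent hDo hxD (hr b hbU).hasFDerivAt hrb (hgrad b hbU)
      (Filter.mem_of_superset (hU.mem_nhds hbU) fun p hp hpr => (hsub.symm.subset ⟨hp, hpr⟩).1)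
      (v := w - b) (fun c => ?_) (by rwa [add_sub_cancel])
    rw [← hT, ← hL, map_smul, map_sub, hLw]
    simp [hb])
  refine le_trans ?_ (le_caraMetric hDo hρ hdisc hf hfD hfz)
  rw [hfX]
  have : 0 < ‖x‖ := norm_pos_iff.2 hx0
  gcongr

open scoped ContDiff in
/-- Upper and lower bounds for the defining function along the complex line `a + ℂ X`, in terms
of the line type. -/
lemma IsCConvex.exists_line_type_bounds {n : ℕ} {D : Set (Cn n)} (hcc : IsCConvex D)
    (hDo : IsOpen D) {a : Cn n} {U : Set (Cn n)} (hU : IsOpen U) (haU : a ∈ U) {r : Cn n → ℝ}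
    (hr : ContDiffAt ℝ ∞ r a) (hra : r a = 0) (hgrad : fderiv ℝ r a ≠ 0)
    (hsub : D ∩ U = {x ∈ U | r x < 0}) {X : Cn n} {l : ℕ}
    (hlow : ∀ k < l, iteratedFDeriv ℝ k (fun w : ℂ => r (a + w • X)) 0 = 0)
    (hord : iteratedFDeriv ℝ l (fun w : ℂ => r (a + w • X)) 0 ≠ 0) :
    0 < l ∧ (∃ K > 0, ∀ᶠ w : ℂ in nhds 0, |r (a + w • X)| ≤ K * ‖w‖ ^ l) ∧
      ∃ e : ℂ, e ≠ 0 ∧ ∃ k > 0, ∀ᶠ s in nhdsWithin (0 : ℝ) (Ioi 0),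
        k * s ^ l ≤ r (a + (s • e) • X) := by
  have hl : 0 < l := by
    rw [Nat.pos_iff_ne_zero]
    rintro rfl
    exact hord (by
      ext
      simp [hra])
  have hh : ContDiffAt ℝ ∞ (fun w : ℂ => r (a + w • X)) 0 :=
    ContDiffAt.comp (0 : ℂ) (g := r) (by simpa using hr) (by fun_prop)
  obtain ⟨hK, e, k, hk, he⟩ := exists_order_bounds hh hlow hord
  have hc : ContinuousAt (fun s : ℝ => a + (s • e) • X) 0 := by fun_prop
  have hcU : ∀ᶠ s in nhdsWithin (0 : ℝ) (Ioi 0), a + (s • e) • X ∈ U :=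
    nhdsWithin_le_nhds (hc.eventually (hU.mem_nhds (by simpa using haU)))
  refine ⟨hl, hK, e, ?_, k, hk, ?_⟩
  · rintro rfl
    rcases he with he | ⟨-, he⟩
    all_goals
      obtain ⟨s, hs, hs0⟩ := (he.and self_mem_nhdsWithin).exists
      have := mul_pos hk (pow_pos hs0 l)
      simp [hra] at hs
      linarith
  · refine he.resolve_right fun ⟨hl1, he⟩ => ?_
    obtain ⟨s, ⟨hs, hsU⟩, hs0⟩ := ((he.and hcU).and self_mem_nhdsWithin).exists
    have hpos := mul_pos hk (pow_pos hs0 l)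
    have hT : ∀ c : ℂ, fderiv ℝ r a (c • X) = 0 := by
      intro c
      have h1 := hlow 1 (by omega)
      have h2 : HasFDerivAt (fun w : ℂ => r (a + w • X))
          ((fderiv ℝ r a).comp ((ContinuousLinearMap.id ℝ ℂ).smulRight X)) 0 := by
        have h3 : HasFDerivAt (fun w : ℂ => a + w • X)
            ((ContinuousLinearMap.id ℝ ℂ).smulRight X) 0 :=
          ((ContinuousLinearMap.id ℝ ℂ).smulRight X).hasFDerivAt.const_add a
        have h4 : HasFDerivAt r (fderiv ℝ r a) (a + (0 : ℂ) • X) := by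
          simpa using (hr.differentiableAt (by simp)).hasFDerivAt
        exact h4.comp (0 : ℂ) h3
      have h5 := congrArg (fun M => M (fun _ => c)) h1
      simp only [iteratedFDeriv_one_apply, h2.fderiv] at h5
      simpa using h5
    have hloc : ∀ x ∈ U, r x < 0 → x ∈ D := fun x hx hxr => (hsub.symm.subset ⟨hx, hxr⟩).1
    refine hcc.add_notMem_of_tangent hDo (fun haD => ?_)
      (hr.differentiableAt (by simp)).hasFDerivAt hra hgrad
      (Filter.mem_of_superset (hU.mem_nhds haU) hloc) (v := (s • e) • X) (fun c => ?_)
      (hloc _ hsU (by linarith))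
    · exact absurd (hsub.subset ⟨haD, haU⟩).2 (by simp [hra])
    · rw [smul_smul]
      exact hT _

/-- Strict differentiability at `a`, in a ball contained in a neighbourhood of `a`. -/
lemma exists_ball_strict_estimate {E : Type*} [NormedAddCommGroup E] [NormedSpace ℝ E]
    {r : E → ℝ} {T : E →L[ℝ] ℝ} {a : E} (hr : HasStrictFDerivAt r T a) {U : Set E}
    (hU : U ∈ nhds a) {η : ℝ} (hη : 0 < η) :
    ∃ δ > 0, ball a δ ⊆ U ∧ ∀ x ∈ ball a δ, ∀ y ∈ ball a δ,
      |r x - r y - T (x - y)| ≤ η * ‖x - y‖ := by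
  have h := hr.isLittleO.def hη
  rw [nhds_prod_eq, Filter.eventually_prod_self_iff'] at h
  obtain ⟨V, hV, h⟩ := h
  obtain ⟨δ, hδ, hsub⟩ := Metric.mem_nhds_iff.1 (Filter.inter_mem hU hV)
  exact ⟨δ, hδ, fun x hx => (hsub hx).1, fun x hx y hy => h x (hsub hx).2 y (hsub hy).2⟩

/-- Along the inner normal, the distance to the boundary is comparable to the distance to the
base point. -/
lemma bdist_bounds_on_normal {n : ℕ} {D : Set (Cn n)} {a : Cn n} (ha : a ∈ frontier D)
    {U : Set (Cn n)} {r : Cn n → ℝ} (hra : r a = 0)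
    (hsub : D ∩ U = {x ∈ U | r x < 0}) (hbd : frontier D ∩ U = {x ∈ U | r x = 0})
    {T : Cn n →L[ℝ] ℝ} (hT : 0 < ‖T‖) {δ : ℝ} (hδU : ball a δ ⊆ U)
    (hest : ∀ x ∈ ball a δ, ∀ y ∈ ball a δ, |r x - r y - T (x - y)| ≤ ‖T‖ / 2 * ‖x - y‖)
    {ν : Cn n} (hν1 : ‖ν‖ = 1) (hν2 : T ν = -‖T‖) {t : ℝ} (ht : |t| < δ / 2)
    (hz : a + t • ν ∈ D) :
    0 < t ∧ t / 4 ≤ bdist D (a + t • ν) ∧ bdist D (a + t • ν) ≤ t := by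
  have hδ : 0 < δ := by linarith [abs_nonneg t]
  have haδ : a ∈ ball a δ := mem_ball_self hδ
  have hda : dist (a + t • ν) a = |t| := by
    rw [dist_self_add_left, norm_smul, hν1, mul_one, Real.norm_eq_abs]
  have hzδ : a + t • ν ∈ ball a δ := by
    rw [mem_ball, hda]
    linarith
  have hrz : r (a + t • ν) < 0 := (hsub.subset ⟨hz, hδU hzδ⟩).2
  have h1 := abs_le.1 (hest _ hzδ _ haδ)
  rw [add_sub_cancel_left, map_smul, hν2, hra, norm_smul, hν1, mul_one, Real.norm_eq_abs,
    smul_eq_mul] at h1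
  have ht0 : 0 < t := by
    by_contra! h
    rw [abs_of_nonpos h] at h1
    nlinarith [mul_nonneg hT.le (neg_nonneg.2 h)]
  rw [abs_of_pos ht0] at h1 hda ht
  refine ⟨ht0, ?_, ?_⟩
  · refine (Metric.le_infDist ⟨a, ha⟩).2 fun {y} hy => ?_
    by_contra! h
    have hyδ : y ∈ ball a δ := by
      have := dist_triangle y (a + t • ν) a
      rw [hda, dist_comm y (a + t • ν)] at this
      rw [mem_ball]
      linarith
    have hry : r y = 0 := (hbd.subset ⟨hy, hδU hyδ⟩).2
    have h2 := abs_le.1 (hest _ hyδ _ hzδ)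
    have h3 := abs_le.1 (T.le_opNorm (y - (a + t • ν)))
    rw [dist_comm, dist_eq_norm] at h
    have h4 := mul_lt_mul_of_pos_left h hT
    linarith [h1.2, h2.2, h3.2, mul_pos hT ht0]
  · exact (Metric.infDist_le_dist_of_mem ha).trans hda.le

lemma rpow_one_div_natCast_pow {l : ℕ} (hl : 0 < l) {x : ℝ} (hx : 0 ≤ x) :
    (x ^ (1 / (l : ℝ))) ^ l = x := by
  rw [one_div, Real.rpow_inv_natCast_pow hx hl.ne']

/-- Small values of the radii `(A t)^{1/l}`. -/
lemma eventually_rpow_of_eventually {A : ℝ} {l : ℕ} (hl : 0 < l) (hA : 0 < A) {p : ℝ → Prop}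
    (h : ∀ᶠ s in nhdsWithin (0 : ℝ) (Ioi 0), p s) :
    ∀ᶠ t in nhdsWithin (0 : ℝ) (Ioi 0), p ((A * t) ^ (1 / (l : ℝ))) := by
  have hl' : 0 < 1 / (l : ℝ) := by positivity
  refine Filter.Tendsto.eventually ?_ h
  refine tendsto_nhdsWithin_iff.2 ⟨?_, ?_⟩
  · have h1 : Filter.Tendsto (fun t : ℝ => A * t) (nhds 0) (nhds 0) := by
      have : ContinuousAt (fun t : ℝ => A * t) 0 := by fun_prop
      simpa using this.tendsto
    have h2 := h1.rpow_const (p := 1 / (l : ℝ)) (Or.inr hl'.le)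
    rw [Real.zero_rpow hl'.ne'] at h2
    exact h2.mono_left nhdsWithin_le_nhds
  · filter_upwards [self_mem_nhdsWithin] with t ht
    exact Real.rpow_pos_of_pos (mul_pos hA ht) _

/-- Under the hypotheses of Statement 5, on the inner normal near `a`,
`c⁻¹ d_D(z)^{-1/l} ≤ γ_D(z;X) ≤ κ_D(z;X) ≤ c d_D(z)^{-1/l}` where `l = l_{a,X}`. -/
theorem statement6 {n : ℕ} (D : Set (Cn n)) (hD : IsDomain' D) (hcc : IsCConvex D)
    (a : Cn n) (ha : a ∈ frontier D)
    (U : Set (Cn n)) (hU : IsOpen U) (haU : a ∈ U) (r : Cn n → ℝ)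
    (hr : ContDiffOn ℝ (⊤ : ℕ∞) r U) (hgrad : ∀ x ∈ U, fderiv ℝ r x ≠ 0)
    (hsub : D ∩ U = {x ∈ U | r x < 0})
    (hbd : frontier D ∩ U = {x ∈ U | r x = 0})
    (X : Cn n) (hX : X ≠ 0) (l : ℕ)
    (hlow : ∀ k < l, iteratedFDeriv ℝ k (fun w : ℂ => r (a + w • X)) 0 = 0)
    (hord : iteratedFDeriv ℝ l (fun w : ℂ => r (a + w • X)) 0 ≠ 0)
    (ν : Cn n) (hν1 : ‖ν‖ = 1) (hν2 : fderiv ℝ r a ν = -‖fderiv ℝ r a‖) :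
    ∃ U' ∈ nhds a, ∃ c > (0:ℝ), ∀ z ∈ D ∩ U', (∃ t : ℝ, z = a + t • ν) →
      c⁻¹ * bdist D z ^ (-1 / (l:ℝ)) ≤ caraMetric D z X ∧
      caraMetric D z X ≤ kobMetric D z X ∧
      kobMetric D z X ≤ c * bdist D z ^ (-1 / (l:ℝ)) := by
  have hDo := hD.1
  have hra : r a = 0 := (hbd.subset ⟨ha, haU⟩).2
  have hrx : ∀ x ∈ U, ContDiffAt ℝ (⊤ : ℕ∞) r x := fun x hx => hr.contDiffAt (hU.mem_nhds hx)
  obtain ⟨hl, ⟨K, hK, hup⟩, e, he, k, hk, hlo⟩ := hcc.exists_line_type_bounds hDo hU haU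
    (hrx a haU) hra (hgrad a haU) hsub hlow hord
  set T := fderiv ℝ r a with hT
  have hβ : 0 < ‖T‖ := norm_pos_iff.2 (hgrad a haU)
  obtain ⟨δ, hδ, hδU, hest⟩ := exists_ball_strict_estimate
    ((hrx a haU).hasStrictFDerivAt (by simp)) (hU.mem_nhds haU) (half_pos hβ)
  rw [← hT] at hest
  have hshift : ∀ t : ℝ, 0 < t → t < δ / 2 → ∀ w : ℂ, ‖w‖ * ‖X‖ < δ / 2 →
      a + t • ν + w • X ∈ U ∧ a + w • X ∈ U ∧
        |r (a + t • ν + w • X) - r (a + w • X) + ‖T‖ * t| ≤ ‖T‖ / 2 * t := by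
    intro t ht0 ht w hw
    have htν : ‖t • ν‖ = t := by rw [norm_smul, hν1, mul_one, Real.norm_of_nonneg ht0.le]
    have hx : a + t • ν + w • X ∈ ball a δ := by
      rw [mem_ball, add_assoc, dist_self_add_left]
      refine (norm_add_le _ _).trans_lt ?_
      rw [htν, norm_smul]
      linarith
    have hy : a + w • X ∈ ball a δ := by
      rw [mem_ball, dist_self_add_left, norm_smul]
      linarith
    refine ⟨hδU hx, hδU hy, ?_⟩
    have h := hest _ hx _ hy
    have h1 : a + t • ν + w • X - (a + w • X) = t • ν := by abel
    rw [h1, htν, map_smul, hν2, smul_eq_mul] at h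
    convert h using 2
    ring
  have hA : 0 < ‖T‖ / (2 * K) := by positivity
  have hB : 0 < 3 * ‖T‖ / (2 * k) := by positivity
  obtain ⟨δ', hδ', hup⟩ := Metric.eventually_nhds_iff_ball.1 hup
  have hsmall : ∀ y > (0 : ℝ), ∀ᶠ s in nhdsWithin (0 : ℝ) (Ioi 0), s < y :=
    fun y hy => nhdsWithin_le_nhds (eventually_lt_nhds hy)
  have hXpos : 0 < ‖X‖ := norm_pos_iff.2 hX
  have hepos : 0 < ‖e‖ := norm_pos_iff.2 he
  have hev : ∀ᶠ t in nhdsWithin (0 : ℝ) (Ioi 0), t < δ / 2 ∧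
      ((‖T‖ / (2 * K) * t) ^ (1 / (l : ℝ)) < δ' ∧
        (‖T‖ / (2 * K) * t) ^ (1 / (l : ℝ)) < δ / 2 / ‖X‖) ∧
      ((3 * ‖T‖ / (2 * k) * t) ^ (1 / (l : ℝ)) < δ / 2 / ‖X‖ / ‖e‖ ∧
        k * ((3 * ‖T‖ / (2 * k) * t) ^ (1 / (l : ℝ))) ^ l ≤
          r (a + (((3 * ‖T‖ / (2 * k) * t) ^ (1 / (l : ℝ))) • e) • X)) :=
    (hsmall _ (by positivity)).and
      ((eventually_rpow_of_eventually hl hA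
          ((hsmall δ' hδ').and (hsmall (δ / 2 / ‖X‖) (by positivity)))).and
        (eventually_rpow_of_eventually hl hB
          ((hsmall (δ / 2 / ‖X‖ / ‖e‖) (by positivity)).and hlo)))
  obtain ⟨ε, hε, hev⟩ := Metric.eventually_nhds_iff_ball.1 (eventually_nhdsWithin_iff.1 hev)
  set cA := (‖T‖ / (2 * K)) ^ (1 / (l : ℝ)) with hcA
  set cB := (3 * ‖T‖ / (2 * k)) ^ (1 / (l : ℝ)) with hcB
  have hcA0 : 0 < cA := Real.rpow_pos_of_pos hA _
  have hcB0 : 0 < cB := Real.rpow_pos_of_pos hB _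
  set C := 32 * Real.pi ^ 2 * (cB * ‖e‖) * 4 ^ (1 / (l : ℝ)) with hC
  have hC0 : 0 < C := by positivity
  refine ⟨ball a (min ε (δ / 2)), ball_mem_nhds a (by positivity), cA⁻¹ + C, by positivity, ?_⟩
  rintro z ⟨hz, hza⟩ ⟨t, rfl⟩
  have htabs : |t| < min ε (δ / 2) := by
    rwa [mem_ball, dist_self_add_left, norm_smul, hν1, mul_one, Real.norm_eq_abs] at hza
  obtain ⟨ht0, hd1, hd2⟩ := bdist_bounds_on_normal ha hra hsub hbd hβ hδU hest hν1 hν2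
    (htabs.trans_le (min_le_right _ _)) hz
  obtain ⟨ht, ⟨hρ1, hρ2⟩, hs1, hs2⟩ := hev t (by
    rw [mem_ball_zero_iff]
    exact htabs.trans_le (min_le_left _ _)) ht0
  set d := bdist D (a + t • ν) with hd
  have hd0 : 0 < d := by linarith
  set ρ := (‖T‖ / (2 * K) * t) ^ (1 / (l : ℝ)) with hρ
  set s := (3 * ‖T‖ / (2 * k) * t) ^ (1 / (l : ℝ)) with hs
  have hρt : ρ = cA * t ^ (1 / (l : ℝ)) := Real.mul_rpow hA.le ht0.le
  have hst : s = cB * t ^ (1 / (l : ℝ)) := Real.mul_rpow hB.le ht0.le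
  have hτ0 : 0 < t ^ (1 / (l : ℝ)) := Real.rpow_pos_of_pos ht0 _
  have hρ0 : 0 < ρ := by rw [hρt]; positivity
  have hs0 : 0 < s := by rw [hst]; positivity
  have hdisc : ∀ w : ℂ, ‖w‖ < ρ → a + t • ν + w • X ∈ D := by
    intro w hw
    obtain ⟨hwU, -, h1⟩ := hshift t ht0 ht w ((lt_div_iff₀ hXpos).1 (hw.trans hρ2))
    refine (hsub.symm.subset ⟨hwU, ?_⟩).1
    have h2 := (abs_le.1 (hup w (mem_ball_zero_iff.2 (hw.trans hρ1)))).2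
    have h3 : K * ‖w‖ ^ l < K * ρ ^ l :=
      mul_lt_mul_of_pos_left (pow_lt_pow_left₀ hw (norm_nonneg _) hl.ne') hK
    have h4 : K * ρ ^ l = ‖T‖ / 2 * t := by
      rw [hρ, rpow_one_div_natCast_pow hl (by positivity)]
      field_simp
    linarith [(abs_le.1 h1).2]
  have hse : ‖s • e‖ = s * ‖e‖ := by rw [norm_smul, Real.norm_of_nonneg hs0.le]
  have hseX : ‖s • e‖ * ‖X‖ < δ / 2 := by
    rw [hse]
    exact (lt_div_iff₀ hXpos).1 ((lt_div_iff₀ hepos).1 hs1)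
  have hnot : a + t • ν + (s • e) • X ∉ D := by
    intro h
    obtain ⟨hwU, -, h1⟩ := hshift t ht0 ht _ hseX
    have h2 := (hsub.subset ⟨h, hwU⟩).2
    have h4 : k * s ^ l = 3 * ‖T‖ / 2 * t := by
      rw [hs, rpow_one_div_natCast_pow hl (by positivity)]
      field_simp
    linarith [(abs_le.1 h1).1]
  have hcara := hcc.le_caraMetric_of_notMem hDo hU
    (fun x hx => (hrx x hx).differentiableAt (by simp)) hgrad hsub hbd hz hnot
    (fun x hx => (hshift t ht0 ht x
      ((mul_le_mul_of_nonneg_right hx (norm_nonneg _)).trans_lt hseX)).1) hρ0 hdisc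
  have hdpow : d ^ (-1 / (l : ℝ)) = (d ^ (1 / (l : ℝ)))⁻¹ := by
    rw [neg_div, Real.rpow_neg hd0.le]
  have hd1' : t ^ (1 / (l : ℝ)) ≤ 4 ^ (1 / (l : ℝ)) * d ^ (1 / (l : ℝ)) := by
    rw [← Real.mul_rpow (by norm_num) hd0.le]
    exact Real.rpow_le_rpow ht0.le (by linarith) (by positivity)
  have hd2' : d ^ (1 / (l : ℝ)) ≤ t ^ (1 / (l : ℝ)) :=
    Real.rpow_le_rpow hd0.le hd2 (by positivity)
  have hdl : 0 < d ^ (1 / (l : ℝ)) := Real.rpow_pos_of_pos hd0 _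
  rw [hdpow]
  refine ⟨le_trans ?_ hcara, caraMetric_le_kobMetric hDo hρ0 hdisc,
    (kobMetric_le_of_linear_disc hρ0 hdisc).trans ?_⟩
  · rw [← mul_inv, hse, hst]
    refine inv_anti₀ (by positivity) ?_
    calc 32 * Real.pi ^ 2 * (cB * t ^ (1 / (l : ℝ)) * ‖e‖)
        = 32 * Real.pi ^ 2 * (cB * ‖e‖) * t ^ (1 / (l : ℝ)) := by ring
      _ ≤ 32 * Real.pi ^ 2 * (cB * ‖e‖) * (4 ^ (1 / (l : ℝ)) * d ^ (1 / (l : ℝ))) := by gcongr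
      _ = C * d ^ (1 / (l : ℝ)) := by ring
      _ ≤ (cA⁻¹ + C) * d ^ (1 / (l : ℝ)) := by
        gcongr
        linarith [inv_pos.2 hcA0]
  · rw [hρt, mul_inv]
    refine mul_le_mul (by linarith) (inv_anti₀ hdl hd2') (by positivity) (by positivity)

end
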